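/- arXiv:2410.14533 — 6 statements merged into one kernel-verified Lean document; each statement's English description precedes it below -/
import Mathlib

section
/- Let (M, dist) be a connected metric space, let d > 1 be a real number and C > 0 a constant such that for every ε ∈ (0,1] the space M can be covered by at most C·ε^{-d} open balls of radius ε with centers in M. Then there exists a constant K > 0 (depending only on C and d) such that for every n ≥ 1 and every collection of points x₁, …, xₙ ∈ M there exists a permutation σ of {1,…,n} with Σ_{i=1}^{n-1} dist(x_{σ(i)}, x_{σ(i+1)}) ≤ K · n^{1 - 1/d}. -/
open scoped BigOperators

/-- The length of the path through the points `x (σ 1), …, x (σ n)` determined by the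
permutation `σ` of `Fin n`: the sum of distances between consecutive points. -/
noncomputable def pathLength {M : Type*} [MetricSpace M] {n : ℕ}
    (x : Fin n → M) (σ : Equiv.Perm (Fin n)) : ℝ :=
  ∑ i : Fin n, if h : (i : ℕ) + 1 < n then dist (x (σ i)) (x (σ ⟨(i : ℕ) + 1, h⟩)) else 0

/-- length of a list path -/
noncomputable def plen {ι M : Type*} [MetricSpace M] (x : ι → M) : List ι → ℝ
  | [] => 0
  | [_] => 0
  | a :: b :: l => dist (x a) (x b) + plen x (b :: l)

theorem plen_insert {ι M : Type*} [MetricSpace M] (x : ι → M) (p q : ι) :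
    ∀ (l : List ι) (a : ι), q ∈ a :: l → ∃ l', (a :: l').Perm (p :: a :: l) ∧
      plen x (a :: l') ≤ plen x (a :: l) + 2 * dist (x p) (x q) := by
  intro l
  induction l with
  | nil =>
    intro a hq
    have : q = a := by simpa using hq
    subst this
    refine ⟨[p], List.Perm.swap _ _ _, ?_⟩
    simp only [plen]
    have := dist_nonneg (x := x p) (y := x q)
    rw [dist_comm (x q)]
    linarith
  | cons b l ih =>
    intro a hq
    by_cases hqa : q = a
    · subst hqa
      refine ⟨p :: b :: l, List.Perm.swap _ _ _, ?_⟩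
      simp only [plen]
      have := dist_triangle (x p) (x q) (x b)
      rw [dist_comm (x q) (x p)]
      linarith
    · have hq' : q ∈ b :: l := by
        rcases List.mem_cons.1 hq with h | h
        · exact absurd h hqa
        · exact h
      obtain ⟨l', h1, h2⟩ := ih b hq'
      refine ⟨b :: l', (h1.cons a).trans (List.Perm.swap _ _ _), ?_⟩
      simp only [plen]
      linarith

theorem plen_eq_sum {ι M : Type*} [MetricSpace M] (x : ι → M) :
    ∀ (l : List ι), plen x l = ∑ i : Fin l.length,
      if h : (i : ℕ) + 1 < l.length then dist (x l[(i : ℕ)]) (x l[(i : ℕ) + 1]) else 0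
  | [] => by simp [plen]
  | [a] => by simp [plen]
  | a :: b :: l => by
    have ih := plen_eq_sum x (b :: l)
    rw [plen, ih]
    simp only [List.length_cons]
    conv_rhs => rw [Fin.sum_univ_succ]
    congr 1
    simp

theorem exists_perm_of_list {M : Type*} [MetricSpace M] {n : ℕ} (x : Fin n → M)
    (L : List (Fin n)) (hL : L.Nodup) (hn : L.length = n) :
    ∃ σ : Equiv.Perm (Fin n), pathLength x σ = plen x L := by
  have hinj : Function.Injective (fun i : Fin n => L[(i : ℕ)]'(by rw [hn]; exact i.2)) := by
    intro i j h
    exact Fin.ext ((hL.getElem_inj_iff).1 h)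
  refine ⟨Equiv.ofBijective _ (Finite.injective_iff_bijective.1 hinj), ?_⟩
  rw [plen_eq_sum, pathLength]
  apply Fintype.sum_equiv (finCongr hn.symm)
  intro i
  simp [hn]

theorem greedy {ι M : Type*} [DecidableEq ι] [MetricSpace M] (x : ι → M) (A c α : ℝ)
    (hα0 : 0 < α) (hα1 : α ≤ 1) (hA : 2 * c = A * α) (hA0 : 0 ≤ A)
    (hc : ∀ s : Finset ι, 2 ≤ s.card → ∃ p ∈ s, ∃ q ∈ s, p ≠ q ∧
      dist (x p) (x q) ≤ c * (s.card : ℝ) ^ (α - 1)) :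
    ∀ (k : ℕ) (s : Finset ι), s.card = k → ∃ L : List ι, L.Perm s.toList ∧
      plen x L ≤ A * (k : ℝ) ^ α := by
  intro k
  induction k with
  | zero =>
    intro s hs
    have : s = ∅ := Finset.card_eq_zero.1 hs
    subst this
    refine ⟨[], by simp, ?_⟩
    simp only [plen]
    positivity
  | succ k ih =>
    intro s hs
    by_cases hk : k = 0
    · subst hk
      obtain ⟨a, rfl⟩ := Finset.card_eq_one.1 hs
      refine ⟨[a], by simp, ?_⟩
      simp only [plen]
      positivity
    · obtain ⟨p, hp, q, hq, hpq, hd⟩ := hc s (by omega)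
      obtain ⟨L, hL, hlen⟩ := ih (s.erase p) (by rw [Finset.card_erase_of_mem hp, hs]; rfl)
      have hqL : q ∈ L := by
        rw [hL.mem_iff]
        simp [hq, hpq.symm]
      obtain ⟨a, l, rfl⟩ : ∃ a l, L = a :: l := by
        cases L with
        | nil => simp at hqL
        | cons a l => exact ⟨a, l, rfl⟩
      obtain ⟨l', h1, h2⟩ := plen_insert x p q l a hqL
      refine ⟨a :: l', ?_, ?_⟩
      · refine h1.trans ((hL.cons p).trans ?_)
        have := Finset.toList_insert (Finset.notMem_erase p s)
        rw [Finset.insert_erase hp] at this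
        exact this.symm
      · rw [hs] at hd
        have hpos : (0 : ℝ) < ((k + 1 : ℕ) : ℝ) := by positivity
        have hb := rpow_one_add_le_one_add_mul_self (s := -(1 / ((k + 1 : ℕ) : ℝ))) (p := α)
          (by
            have : 1 / ((k + 1 : ℕ) : ℝ) ≤ 1 := by
              rw [div_le_one hpos]; push_cast; linarith [(Nat.cast_nonneg k : (0 : ℝ) ≤ k)]
            linarith) hα0.le hα1
        have e1 : (k : ℝ) = ((k + 1 : ℕ) : ℝ) * (1 + -(1 / ((k + 1 : ℕ) : ℝ))) := by
          field_simp; push_cast; ring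
        have hnn : 0 ≤ 1 + -(1 / ((k + 1 : ℕ) : ℝ)) := by
          have : 0 ≤ (k : ℝ) := by positivity
          rw [e1] at this
          exact nonneg_of_mul_nonneg_right this hpos
        have e2 : (k : ℝ) ^ α = ((k + 1 : ℕ) : ℝ) ^ α * (1 + -(1 / ((k + 1 : ℕ) : ℝ))) ^ α := by
          rw [← Real.mul_rpow hpos.le hnn, ← e1]
        have e3 : ((k + 1 : ℕ) : ℝ) ^ (α - 1) = ((k + 1 : ℕ) : ℝ) ^ α * (1 / ((k + 1 : ℕ) : ℝ)) := by
          rw [Real.rpow_sub_one hpos.ne']; ring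
        rw [e3] at hd
        rw [e2] at hlen
        have hR : 0 ≤ A * ((k + 1 : ℕ) : ℝ) ^ α := by positivity
        have := mul_le_mul_of_nonneg_left hb hR
        generalize ((k + 1 : ℕ) : ℝ) ^ α = R at *
        generalize (1 / ((k + 1 : ℕ) : ℝ)) = r at *
        have h5 : 2 * c * (R * r) = A * α * (R * r) := by rw [hA]
        nlinarith

theorem diam_bound {M : Type*} [MetricSpace M] [ConnectedSpace M] (Z : Finset M)
    (hZ : ∀ x : M, ∃ z ∈ Z, dist x z < 1) (x y : M) : dist x y ≤ 2 * Z.card := by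
  have hI : Set.Icc (dist x x) (dist x y) ⊆ Set.range (fun t => dist x t) :=
    intermediate_value_univ x y (by fun_prop)
  set m := ⌊dist x y / 2⌋₊ with hm
  have hp : ∀ i : Fin (m + 1), ∃ z ∈ Z, ∃ p : M, dist x p = 2 * (i : ℕ) ∧ dist p z < 1 := by
    intro i
    have h1 : ((i : ℕ) : ℝ) ≤ m := by exact_mod_cast Nat.lt_succ_iff.1 i.2
    have h2 : (m : ℝ) ≤ dist x y / 2 := Nat.floor_le (by positivity)
    obtain ⟨p, hp⟩ := hI (show (2 * ((i : ℕ) : ℝ)) ∈ _ from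
      ⟨by rw [dist_self]; positivity, by linarith⟩)
    obtain ⟨z, hz, hpz⟩ := hZ p
    exact ⟨z, hz, p, hp, hpz⟩
  choose z hz p hp1 hp2 using hp
  have hinj : Function.Injective z := by
    intro i j hij
    have a1 := hp2 i
    have a2 := hp2 j
    rw [hij] at a1
    have a3 := dist_triangle_right (p i) (p j) (z j)
    have a4 := dist_triangle x (p i) (p j)
    have a5 := dist_triangle x (p j) (p i)
    rw [dist_comm (p j) (p i)] at a5
    rw [hp1, hp1] at a4 a5
    have b1 : ((j : ℕ) : ℝ) < (i : ℕ) + 1 := by linarith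
    have b2 : ((i : ℕ) : ℝ) < (j : ℕ) + 1 := by linarith
    have c1 : (j : ℕ) < (i : ℕ) + 1 := by exact_mod_cast b1
    have c2 : (i : ℕ) < (j : ℕ) + 1 := by exact_mod_cast b2
    exact Fin.ext (by omega)
  have hcard : m + 1 ≤ Z.card := by
    have := Finset.card_le_card_of_injOn (s := Finset.univ) (t := Z) z (fun i _ => hz i)
      (hinj.injOn)
    simpa using this
  have h3 : dist x y / 2 < m + 1 := Nat.lt_floor_add_one _
  have h4 : (m : ℝ) + 1 ≤ Z.card := by exact_mod_cast hcard
  linarith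

/-- Upper-bound half of Theorem 1: in a connected metric space of Minkowski dimension
at most `d` (quantified by the covering hypothesis with constant `C`), there is a constant
`K > 0` depending only on `C` and `d` such that any `n` points admit a path through them
of length at most `K * n ^ (1 - 1/d)`. -/
theorem shortest_path_upper_bound (d C : ℝ) (hd : 1 < d) (hC : 0 < C) :
    ∃ K > 0, ∀ (M : Type) [MetricSpace M] [ConnectedSpace M],
      (∀ ε : ℝ, 0 < ε → ε ≤ 1 → ∃ Z : Finset M,
        (Z.card : ℝ) ≤ C * ε ^ (-d) ∧ ∀ x : M, ∃ z ∈ Z, dist x z < ε) →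
      ∀ n : ℕ, 1 ≤ n → ∀ x : Fin n → M, ∃ σ : Equiv.Perm (Fin n),
        pathLength x σ ≤ K * (n : ℝ) ^ (1 - 1 / d) := by
  have hd0 : 0 < d := by linarith
  have hα0 : 0 < 1 - 1 / d := by
    have : 1 / d < 1 := by rw [div_lt_one hd0]; exact hd
    linarith
  have hα1 : 1 - 1 / d ≤ 1 := by
    have : 0 < 1 / d := by positivity
    linarith
  set c : ℝ := (2 + 2 * C) * (2 * C) ^ (1 / d) with hcdef
  have hcpos : 0 < c := by positivity
  refine ⟨2 * c / (1 - 1 / d), by positivity, ?_⟩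
  intro M _ _ hcov n hn x
  have hdiam : ∀ a b : M, dist a b ≤ 2 * C := by
    intro a b
    obtain ⟨Z, hZ1, hZ2⟩ := hcov 1 one_pos le_rfl
    rw [Real.one_rpow, mul_one] at hZ1
    have := diam_bound Z hZ2 a b
    linarith
  have key : ∀ s : Finset (Fin n), 2 ≤ s.card → ∃ p ∈ s, ∃ q ∈ s, p ≠ q ∧
      dist (x p) (x q) ≤ c * (s.card : ℝ) ^ ((1 - 1 / d) - 1) := by
    intro s hs
    have hkpos : (0 : ℝ) < s.card := by exact_mod_cast (by omega : 0 < s.card)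
    have hce : c * (s.card : ℝ) ^ ((1 - 1 / d) - 1)
        = (2 + 2 * C) * (2 * C / s.card) ^ (1 / d) := by
      rw [hcdef, Real.div_rpow (by positivity) hkpos.le,
        show (1 - 1 / d) - 1 = -(1 / d) by ring, Real.rpow_neg hkpos.le]
      ring
    rw [hce]
    by_cases hk : 2 * C ≤ s.card
    · set ε : ℝ := (2 * C / s.card) ^ (1 / d) with hε
      have hεpos : 0 < ε := by positivity
      have hε1 : ε ≤ 1 := by
        apply Real.rpow_le_one (by positivity) _ (by positivity)
        rw [div_le_one hkpos]; exact hk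
      obtain ⟨Z, hZ1, hZ2⟩ := hcov ε hεpos hε1
      have hεd : C * ε ^ (-d) = s.card / 2 := by
        rw [hε, ← Real.rpow_mul (by positivity),
          show 1 / d * -d = -1 by field_simp, Real.rpow_neg_one]
        field_simp
      rw [hεd] at hZ1
      have hlt : Z.card < s.card := by
        have : (Z.card : ℝ) < s.card := by linarith
        exact_mod_cast this
      choose z hz hzd using hZ2
      obtain ⟨p, hp, q, hq, hpq, he⟩ := Finset.exists_ne_map_eq_of_card_lt_of_maps_to hlt
        (f := fun i => z (x i)) (fun i _ => hz (x i))
      refine ⟨p, hp, q, hq, hpq, ?_⟩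
      have h1 := hzd (x p)
      have h2 := hzd (x q)
      rw [he] at h1
      have h3 := dist_triangle_right (x p) (x q) (z (x q))
      have h4 : 0 ≤ C * ε := by positivity
      linarith
    · push Not at hk
      obtain ⟨p, hp, q, hq, hpq⟩ := Finset.one_lt_card.1 (by omega : 1 < s.card)
      refine ⟨p, hp, q, hq, hpq, (hdiam _ _).trans ?_⟩
      have : 1 ≤ (2 * C / s.card) ^ (1 / d) := by
        apply Real.one_le_rpow _ (by positivity)
        rw [one_le_div hkpos]; exact hk.le
      nlinarith
  obtain ⟨L, hL, hlen⟩ := greedy x (2 * c / (1 - 1 / d)) c (1 - 1 / d) hα0 hα1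
    (div_mul_cancel₀ _ hα0.ne').symm (by positivity) key n Finset.univ (by simp)
  obtain ⟨σ, hσ⟩ := exists_perm_of_list x L (hL.nodup_iff.2 (Finset.nodup_toList _))
    (by rw [hL.length_eq]; simp)
  exact ⟨σ, hσ ▸ hlen⟩
end

section
/- Let (M, dist) be a metric space, let d > 1 be a real number and c > 0 a constant such that for every ε ∈ (0,1] there exist at least c·ε^{-d} points of M that are pairwise at distance at least ε. Then there exists a constant K > 0 (depending only on c and d) such that for all sufficiently large n there exist n points x₁, …, xₙ ∈ M for which every permutation σ of {1,…,n} satisfies Σ_{i=1}^{n-1} dist(x_{σ(i)}, x_{σ(i+1)}) ≥ K · n^{1 - 1/d}. -/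
open scoped BigOperators

/-- Tightness (lower-bound) half of Theorem 1: in a metric space of Minkowski dimension
at least `d` (quantified by the packing hypothesis with constant `c`), there is a constant
`K > 0` depending only on `c` and `d` such that for all sufficiently large `n` there exist
`n` points through which every path has length at least `K * n ^ (1 - 1/d)`. -/
theorem shortest_path_lower_bound (d c : ℝ) (hd : 1 < d) (hc : 0 < c) :
    ∃ K > 0, ∀ (M : Type) [MetricSpace M],
      (∀ ε : ℝ, 0 < ε → ε ≤ 1 → ∃ Z : Finset M,
        c * ε ^ (-d) ≤ (Z.card : ℝ) ∧
          ∀ z₁ ∈ Z, ∀ z₂ ∈ Z, z₁ ≠ z₂ → ε ≤ dist z₁ z₂) →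
      ∃ N : ℕ, ∀ n : ℕ, N ≤ n → ∃ x : Fin n → M,
        ∀ σ : Equiv.Perm (Fin n), K * (n : ℝ) ^ (1 - 1 / d) ≤ pathLength x σ := by
  refine ⟨c ^ (1 / d) / 2, by positivity, ?_⟩
  intro M _ H
  refine ⟨max 2 ⌈c⌉₊, fun n hn => ?_⟩
  have hn2 : 2 ≤ n := le_trans (le_max_left _ _) hn
  have hcn : c ≤ n := le_trans (Nat.le_ceil c) (by exact_mod_cast le_trans (le_max_right _ _) hn)
  have hn2' : (2 : ℝ) ≤ n := by exact_mod_cast hn2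
  have hn0 : (0 : ℝ) < n := by linarith
  have hd0 : d ≠ 0 := by linarith
  have hq : 0 < c / n := by positivity
  have he0 : 0 < (c / n) ^ (1 / d) := by positivity
  obtain ⟨Z, hZ, hsep⟩ := H ((c / n) ^ (1 / d)) he0
    (Real.rpow_le_one hq.le ((div_le_one hn0).2 hcn) (by positivity))
  have hpow : c * ((c / n) ^ (1 / d)) ^ (-d) = n := by
    rw [← Real.rpow_mul hq.le]
    have : 1 / d * -d = -1 := by field_simp
    rw [this, Real.rpow_neg_one]
    field_simp
  rw [hpow] at hZ
  have hcard : n ≤ Z.card := by exact_mod_cast hZ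
  set e := (c / n) ^ (1 / d) with he
  let x : Fin n → M := fun i => (Z.equivFin.symm (Fin.castLE hcard i) : M)
  have hx : Function.Injective x := by
    intro i j hij
    exact Fin.castLE_injective hcard (Z.equivFin.symm.injective (Subtype.ext hij))
  have hxe : ∀ i j, i ≠ j → e ≤ dist (x i) (x j) := fun i j hij =>
    hsep _ (Finset.coe_mem _) _ (Finset.coe_mem _) (fun h => hij (hx h))
  clear_value x
  refine ⟨x, fun σ => ?_⟩
  have h1 : ((n : ℝ) - 1) * e ≤ pathLength x σ := by
    obtain ⟨m, rfl⟩ : ∃ m, n = m + 1 := ⟨n - 1, by omega⟩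
    unfold pathLength
    rw [Fin.sum_univ_castSucc]
    have : ∀ i ∈ (Finset.univ : Finset (Fin m)), e ≤ (if h : ((i.castSucc : Fin (m+1)) : ℕ) + 1 < m + 1 then
        dist (x (σ i.castSucc)) (x (σ ⟨((i.castSucc : Fin (m+1)) : ℕ) + 1, h⟩)) else 0) := by
      intro i _
      have hi : ((i.castSucc : Fin (m+1)) : ℕ) + 1 < m + 1 := by simp
      rw [dif_pos hi]
      apply hxe
      intro h
      have := congrArg Fin.val (σ.injective h)
      simp at this
    have h2 := Finset.card_nsmul_le_sum _ _ _ this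
    simp only [Finset.card_univ, Fintype.card_fin, nsmul_eq_mul] at h2
    rw [dif_neg (by simp)]
    push_cast
    linarith
  have h3 : c ^ (1 / d) / 2 * (n : ℝ) ^ (1 - 1 / d) = n / 2 * e := by
    rw [he, Real.div_rpow hc.le hn0.le, Real.rpow_sub hn0, Real.rpow_one]
    ring
  rw [h3]
  refine le_trans ?_ h1
  gcongr
  linarith
end

section
/- Let (M, dist) be a connected metric space, ε > 0, and suppose M is covered by n open balls of radius ε with centers z₁, …, zₙ ∈ M. Then there exists a permutation σ of {1,…,n} such that Σ_{i=1}^{n-1} dist(z_{σ(i)}, z_{σ(i+1)}) ≤ 4·n·ε. -/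
open scoped BigOperators

/-- Length of the polygonal path through a list of points. -/
noncomputable def listLen {M : Type*} [MetricSpace M] : List M → ℝ
  | [] => 0
  | [_] => 0
  | a :: b :: l => dist a b + listLen (b :: l)

theorem listLen_insert {M : Type*} [MetricSpace M] (i j : M) (l₂ : List M) :
    ∀ l₁ : List M, listLen (l₁ ++ i :: j :: l₂) ≤ listLen (l₁ ++ i :: l₂) + 2 * dist i j
  | [] => by
    cases l₂ with
    | nil => simp only [List.nil_append, listLen]; linarith [dist_nonneg (x := i) (y := j)]
    | cons w l =>
      simp only [List.nil_append, listLen]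
      linarith [dist_triangle_left j w i]
  | [a] => by
    have := listLen_insert i j l₂ []
    simp only [List.nil_append, List.cons_append, listLen] at *
    linarith
  | a :: b :: l => by
    have := listLen_insert i j l₂ (b :: l)
    simp only [List.cons_append, listLen] at *
    linarith

theorem listLen_ofFn {M : Type*} [MetricSpace M] : ∀ (n : ℕ) (f : Fin n → M),
    (∑ i : Fin n, if h : (i : ℕ) + 1 < n then dist (f i) (f ⟨(i : ℕ) + 1, h⟩) else 0)
      = listLen (List.ofFn f)
  | 0, f => by simp [listLen]
  | 1, f => by simp [listLen]
  | n + 2, f => by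
    have := listLen_ofFn (n + 1) (fun i => f i.succ)
    rw [List.ofFn_succ, List.ofFn_succ, listLen, ← List.ofFn_succ (f := fun i => f i.succ), ← this,
      Fin.sum_univ_succ]
    congr 1
    · refine Finset.sum_congr rfl fun i _ => ?_
      by_cases h : (i : ℕ) + 1 < n + 1
      · have h' : ((i.succ : Fin (n+2)) : ℕ) + 1 < n + 2 := by simp; omega
        rw [dif_pos h, dif_pos h']
        rfl
      · have h' : ¬ ((i.succ : Fin (n+2)) : ℕ) + 1 < n + 2 := by simp; omega
        rw [dif_neg h, dif_neg h']

theorem exists_close {M : Type*} [MetricSpace M] [ConnectedSpace M]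
    {n : ℕ} (ε : ℝ) (hε : 0 < ε) (z : Fin n → M)
    (hcover : ∀ x : M, ∃ i : Fin n, dist x (z i) < ε) (P : Fin n → Prop)
    (h1 : ∃ i, P i) (h2 : ∃ i, ¬ P i) :
    ∃ i j, P i ∧ ¬ P j ∧ dist (z i) (z j) < 2 * ε := by
  obtain ⟨a, ha⟩ := h1
  obtain ⟨b, hb⟩ := h2
  have key := (isPreconnected_univ (α := M)) (⋃ i, ⋃ _ : P i, Metric.ball (z i) ε)
    (⋃ i, ⋃ _ : ¬ P i, Metric.ball (z i) ε)
    (isOpen_iUnion fun i => isOpen_iUnion fun _ => Metric.isOpen_ball)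
    (isOpen_iUnion fun i => isOpen_iUnion fun _ => Metric.isOpen_ball)
    (by
      intro x _
      obtain ⟨i, hi⟩ := hcover x
      by_cases h : P i
      · left; simp only [Set.mem_iUnion]; exact ⟨i, h, hi⟩
      · right; simp only [Set.mem_iUnion]; exact ⟨i, h, hi⟩)
    ⟨z a, trivial, by simp only [Set.mem_iUnion]; exact ⟨a, ha, Metric.mem_ball_self hε⟩⟩
    ⟨z b, trivial, by simp only [Set.mem_iUnion]; exact ⟨b, hb, Metric.mem_ball_self hε⟩⟩
  obtain ⟨x, -, hx1, hx2⟩ := key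
  simp only [Set.mem_iUnion, Metric.mem_ball] at hx1 hx2
  obtain ⟨i, hi, hxi⟩ := hx1
  obtain ⟨j, hj, hxj⟩ := hx2
  exact ⟨i, j, hi, hj, by linarith [dist_triangle_left (z i) (z j) x]⟩

theorem exists_list {M : Type*} [MetricSpace M] [ConnectedSpace M]
    {n : ℕ} (ε : ℝ) (hε : 0 < ε) (z : Fin n → M)
    (hcover : ∀ x : M, ∃ i : Fin n, dist x (z i) < ε) (k : ℕ) (hk : k ≤ n) :
    ∃ l : List (Fin n), l.Nodup ∧ l.length = k ∧ listLen (l.map z) ≤ 4 * k * ε := by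
  induction k with
  | zero => exact ⟨[], by simp [listLen]⟩
  | succ k ih =>
    obtain ⟨l, hl, hlen, hle⟩ := ih (by omega)
    rcases Nat.eq_zero_or_pos k with rfl | hpos
    · refine ⟨[⟨0, by omega⟩], by simp, by simp, ?_⟩
      simp only [List.map, listLen]; positivity
    obtain ⟨i, j, hi, hj, hij⟩ := exists_close ε hε z hcover (fun i => i ∈ l)
      (List.exists_mem_of_length_pos (by omega))
      (by
        by_contra! h
        have := Finset.card_le_card (s := Finset.univ) (t := l.toFinset) (by intro i _; simpa using h i)
        have h3 := l.toFinset_card_le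
        simp at this
        omega)
    obtain ⟨l₁, l₂, rfl⟩ := List.append_of_mem hi
    refine ⟨l₁ ++ i :: j :: l₂, ?_, by simp at hlen ⊢; omega, ?_⟩
    · have hp : (l₁ ++ i :: j :: l₂).Perm (j :: (l₁ ++ i :: l₂)) := by
        have := List.perm_middle (a := j) (l₁ := l₁ ++ [i]) (l₂ := l₂)
        simpa using this
      rw [hp.nodup_iff]
      exact List.nodup_cons.2 ⟨hj, hl⟩
    · have := listLen_insert (z i) (z j) (l₂.map z) (l₁.map z)
      simp only [List.map_append, List.map_cons] at hle ⊢
      push_cast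
      linarith

/-- Intermediate claim in the proof of Theorem 1: if a connected metric space is covered by
`n` open `ε`-balls with centers `z₁, …, zₙ`, there is a path through the centers of length
at most `4 * n * ε`. -/
theorem path_through_cover_centers {M : Type*} [MetricSpace M] [ConnectedSpace M]
    {n : ℕ} (ε : ℝ) (hε : 0 < ε) (z : Fin n → M)
    (hcover : ∀ x : M, ∃ i : Fin n, dist x (z i) < ε) :
    ∃ σ : Equiv.Perm (Fin n), pathLength z σ ≤ 4 * n * ε := by
  obtain ⟨l, hl, hlen, hle⟩ := exists_list ε hε z hcover n le_rfl
  have hinj : Function.Injective (fun i : Fin n => l.get (i.cast hlen.symm)) := by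
    intro a b hab
    have := (List.nodup_iff_injective_get.1 hl) hab
    simpa using this
  refine ⟨Equiv.ofBijective _ (Finite.injective_iff_bijective.1 hinj), ?_⟩
  refine le_of_eq_of_le ?_ hle
  unfold pathLength
  rw [listLen_ofFn n (fun i => z (Equiv.ofBijective _ (Finite.injective_iff_bijective.1 hinj) i))]
  congr 1
  apply List.ext_get
  · simp [hlen]
  · intro m h1 h2
    simp
end

section
/- Let (M, dist) be a metric space, ε > 0, and let z₁, …, zₙ ∈ M be points listed in a fixed order with L = Σ_{i=1}^{n-1} dist(zᵢ, z_{i+1}). Let x₁, …, x_m ∈ M be points together with an assignment f : {1,…,m} → {1,…,n} such that dist(x_k, z_{f(k)}) < ε for every k. Then there exists a permutation σ of {1,…,m} such that Σ_{k=1}^{m-1} dist(x_{σ(k)}, x_{σ(k+1)}) ≤ L + 2·m·ε. -/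
open scoped BigOperators

/-- Detour lemma from the proof of Theorem 1: given reference centers `z₁, …, zₙ` listed in
a fixed order with consecutive length `L`, any points `x₁, …, x_m` each lying within `ε` of
its assigned center admit a path through them of length at most `L + 2 * m * ε`. -/
theorem detour_lemma {M : Type*} [MetricSpace M] {n m : ℕ} (ε : ℝ) (hε : 0 < ε)
    (z : Fin n → M) (L : ℝ) (hL : L = pathLength z (Equiv.refl (Fin n)))
    (x : Fin m → M) (f : Fin m → Fin n)
    (hassign : ∀ k : Fin m, dist (x k) (z (f k)) < ε) :
    ∃ σ : Equiv.Perm (Fin m), pathLength x σ ≤ L + 2 * m * ε := by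
  have hL0 : 0 ≤ L := by
    rw [hL]; unfold pathLength
    apply Finset.sum_nonneg
    intro i _
    split_ifs <;> simp
  refine ⟨Tuple.sort f, ?_⟩
  have hmono := Tuple.monotone_sort f
  generalize Tuple.sort f = σ at hmono
  rcases m with _ | m
  · simpa [pathLength] using hL0
  have hn : 0 < n := (f 0).pos
  let z' : ℕ → M := fun i => z ⟨min i (n - 1), by omega⟩
  let S : ℕ → ℝ := fun j => ∑ i ∈ Finset.range j, dist (z' i) (z' (i + 1))
  have hz' : ∀ a : Fin n, z' a = z a := by
    intro a
    have : min (a : ℕ) (n - 1) = a := by omega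
    simp only [z', this]
  have hSn : S n = L := by
    rw [hL]; unfold pathLength
    simp only [S]
    rw [Finset.sum_range]
    apply Finset.sum_congr rfl
    intro i _
    split_ifs with h
    · rw [hz' i, hz' ⟨(i : ℕ) + 1, h⟩]; rfl
    · have h1 : min ((i : ℕ) + 1) (n - 1) = min (i : ℕ) (n - 1) := by omega
      simp only [z', h1, dist_self]
  have hSm : ∀ a b, a ≤ b → S a ≤ S b := by
    intro a b hab
    exact Finset.sum_le_sum_of_subset_of_nonneg (by simpa using hab) (fun _ _ _ => dist_nonneg)
  have hSd : ∀ a b, a ≤ b → dist (z' a) (z' b) ≤ S b - S a := by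
    intro a b hab
    have := dist_le_Ico_sum_dist z' hab
    rwa [Finset.sum_Ico_eq_sub _ hab] at this
  let y : ℕ → ℕ := fun k => f (σ ⟨min k m, by omega⟩)
  have hy : ∀ k : Fin (m + 1), y k = f (σ k) := by
    intro k
    have : min (k : ℕ) m = k := by omega
    simp only [y, this]
  have hym : ∀ a b, a ≤ b → y a ≤ y b := by
    intro a b hab
    exact hmono (show (⟨min a m, by omega⟩ : Fin (m + 1)) ≤ ⟨min b m, by omega⟩ from
      Fin.mk_le_mk.2 (by omega))
  have key : pathLength x σ ≤ ∑ k : Fin (m + 1), ((S (y (k + 1)) - S (y k)) + 2 * ε) := by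
    unfold pathLength
    apply Finset.sum_le_sum
    intro k _
    have h0 := hym k (k + 1) (by omega)
    split_ifs with h
    · have h1 := hSd _ _ h0
      have e2 : y ((k : ℕ) + 1) = f (σ ⟨(k : ℕ) + 1, h⟩) := hy ⟨(k : ℕ) + 1, h⟩
      have a1 := hassign (σ k)
      have a2 := hassign (σ ⟨(k : ℕ) + 1, h⟩)
      rw [hy k, e2, hz', hz'] at h1
      rw [hy k, e2]
      rw [dist_comm] at a2
      have := dist_triangle4 (x (σ k)) (z (f (σ k))) (z (f (σ ⟨(k : ℕ) + 1, h⟩)))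
        (x (σ ⟨(k : ℕ) + 1, h⟩))
      linarith
    · have := hSm _ _ h0
      linarith
  have tel : ∑ k : Fin (m + 1), (S (y (k + 1)) - S (y k)) = S (y (m + 1)) - S (y 0) := by
    rw [← Finset.sum_range (fun k => S (y (k + 1)) - S (y k))]
    exact Finset.sum_range_sub (fun k => S (y k)) (m + 1)
  rw [Finset.sum_add_distrib, tel] at key
  have b1 : S (y (m + 1)) ≤ S n := hSm _ _ (f _).isLt.le
  have b2 : 0 ≤ S (y 0) := Finset.sum_nonneg (fun _ _ => dist_nonneg)
  simp only [Finset.sum_const, Finset.card_univ, Fintype.card_fin, nsmul_eq_mul] at key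
  linarith
end

section
/- Let (M, dist) be a connected metric space with diameter at most D < ∞, let d > 1 and C > 0 be such that for every ε ∈ (0,1] the space M can be covered by at most C·ε^{-d} open balls of radius ε with centers in M. Then there exists a constant K > 0 (depending only on C and d) with the following property: for every sequence of points x₁, …, x_T ∈ M and every partition of the index set {1,…,T} into N consecutive blocks, one can reorder the points within each block (leaving the block order unchanged) so that the resulting sequence y₁, …, y_T satisfies Σ_{t=1}^{T-1} dist(y_t, y_{t+1}) ≤ K · N^{1/d} · T^{1 - 1/d} + N·D. -/
open scoped BigOperators

namespace BRB

noncomputable def plen {M : Type} [MetricSpace M] (f : ℕ → M) : List ℕ → ℝ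
  | [] => 0
  | [_] => 0
  | a :: b :: l => dist (f a) (f b) + plen f (b :: l)

lemma plen_insert {M : Type} [MetricSpace M] (f : ℕ → M) (p q : ℕ) :
    ∀ (t : List ℕ) (a : ℕ), p ∈ a :: t → ∃ t' : List ℕ, t'.Perm (q :: t) ∧
      plen f (a :: t') ≤ plen f (a :: t) + 2 * dist (f p) (f q) := by
  intro t
  induction t with
  | nil =>
    intro a h
    have : p = a := by simpa using h
    subst this
    refine ⟨[q], List.Perm.refl _, ?_⟩
    simp only [plen]
    have := dist_nonneg (x := f p) (y := f q)
    linarith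
  | cons b t ih =>
    intro a h
    by_cases hp : p = a
    · subst hp
      refine ⟨q :: b :: t, List.Perm.refl _, ?_⟩
      simp only [plen]
      have := dist_triangle_left (f q) (f b) (f p)
      linarith
    · have h' : p ∈ b :: t := by
        rcases List.mem_cons.1 h with h | h
        · exact absurd h hp
        · exact h
      obtain ⟨t', h1, h2⟩ := ih b h'
      refine ⟨b :: t', ?_, ?_⟩
      · exact (h1.cons b).trans (List.Perm.swap _ _ _)
      · simp only [plen]
        linarith

lemma plen_append {M : Type} [MetricSpace M] (f : ℕ → M) (D : ℝ) (hD : 0 ≤ D)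
    (h : ∀ x y : M, dist x y ≤ D) (l' : List ℕ) :
    ∀ l : List ℕ, plen f (l ++ l') ≤ plen f l + plen f l' + D := by
  intro l
  induction l with
  | nil => simp [plen]; exact hD
  | cons a t ih =>
    cases t with
    | nil =>
      cases l' with
      | nil => simpa [plen] using hD
      | cons b l' => simp only [List.cons_append, List.nil_append, plen]; linarith [h (f a) (f b)]
    | cons b t =>
      simp only [List.cons_append, plen] at ih ⊢
      linarith

lemma plen_eq {M : Type} [MetricSpace M] (f : ℕ → M) :
    ∀ l : List ℕ, plen f l = ∑ i : Fin l.length,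
      if h : (i : ℕ) + 1 < l.length then dist (f l[(i : ℕ)]) (f l[(i : ℕ) + 1]) else 0 := by
  intro l
  induction l with
  | nil => simp [plen]
  | cons a t ih =>
    cases t with
    | nil => simp [plen]
    | cons b t =>
      rw [plen, ih]
      simp only [List.length_cons]
      rw [Fin.sum_univ_succ (n := t.length + 1)]
      simp

lemma dist_le {M : Type} [MetricSpace M] [ConnectedSpace M] (Z : Finset M)
    (hZ : ∀ x : M, ∃ z ∈ Z, dist x z < 1) (p q : M) : dist p q ≤ 2 * Z.card := by
  by_contra! hlt
  have hr : ∀ k : ℕ, k ≤ Z.card → ∃ y : M, dist p y = 2 * k := by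
    intro k hk
    have hc : Continuous (fun y : M => dist p y) := by fun_prop
    have := intermediate_value_univ p q hc
    apply this
    have hk' : (k : ℝ) ≤ Z.card := by exact_mod_cast hk
    simp only [dist_self, Set.mem_Icc]
    constructor
    · positivity
    · linarith
  choose! y hy using hr
  choose g hg hg' using hZ
  have hcard : Z.card < (Finset.range (Z.card + 1)).card := by simp
  obtain ⟨i, hi, j, hj, hij, he⟩ := Finset.exists_ne_map_eq_of_card_lt_of_maps_to hcard
    (f := fun k => g (y k)) (fun k _ => hg _)
  have hi' := hy i (by simp at hi; omega)
  have hj' := hy j (by simp at hj; omega)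
  have h1 := hg' (y i)
  have h2 := hg' (y j)
  rw [← he] at h2
  have h3 := dist_triangle_right (y i) (y j) (g (y i))
  have h4 := abs_dist_sub_le (y i) (y j) p
  rw [dist_comm (y i) p, dist_comm (y j) p, hi', hj', abs_le] at h4
  rcases lt_or_gt_of_ne hij with h | h
  · have : (i : ℝ) + 1 ≤ j := by exact_mod_cast h
    linarith
  · have : (j : ℝ) + 1 ≤ i := by exact_mod_cast h
    linarith

lemma pair {M : Type} [MetricSpace M] (d C : ℝ) (hd : 1 < d) (hC : 0 < C)
    (hdist : ∀ p q : M, dist p q ≤ 2 * C)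
    (hcov : ∀ ε : ℝ, 0 < ε → ε ≤ 1 → ∃ Z : Finset M,
        (Z.card : ℝ) ≤ C * ε ^ (-d) ∧ ∀ x : M, ∃ z ∈ Z, dist x z < ε)
    (f : ℕ → M) (s : Finset ℕ) (hs : 2 ≤ s.card) :
    ∃ i ∈ s, ∃ j ∈ s, i ≠ j ∧
      dist (f i) (f j) ≤ (2 + 2 * C) * (2 * C) ^ (1 / d) * (s.card : ℝ) ^ (-(1 / d)) := by
  have hn : (0 : ℝ) < s.card := by
    have : 0 < s.card := by omega
    exact_mod_cast this
  set ε : ℝ := (2 * C) ^ (1 / d) * (s.card : ℝ) ^ (-(1 / d)) with hε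
  have hε0 : 0 < ε := by positivity
  rw [mul_assoc, ← hε]
  rcases le_or_gt ε 1 with h1 | h1
  · obtain ⟨Z, hZc, hZ⟩ := hcov ε hε0 h1
    have hpow : ε ^ (-d) = s.card / (2 * C) := by
      rw [hε, Real.mul_rpow (by positivity) (by positivity), ← Real.rpow_mul (by positivity),
        ← Real.rpow_mul (by positivity)]
      have e1 : 1 / d * -d = -1 := by field_simp
      have e2 : -(1 / d) * -d = 1 := by field_simp
      rw [e1, e2, Real.rpow_one, Real.rpow_neg_one]
      field_simp
    rw [hpow] at hZc
    have hlt : (Z.card : ℝ) < s.card := by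
      have : C * (s.card / (2 * C)) = (s.card : ℝ) / 2 := by field_simp
      linarith
    have hlt' : Z.card < s.card := by exact_mod_cast hlt
    choose g hg hg' using hZ
    obtain ⟨i, hi, j, hj, hij, he⟩ := Finset.exists_ne_map_eq_of_card_lt_of_maps_to hlt'
      (f := fun k => g (f k)) (fun k _ => hg _)
    refine ⟨i, hi, j, hj, hij, ?_⟩
    have h1 := hg' (f i)
    have h2 := hg' (f j)
    rw [← he] at h2
    have h3 := dist_triangle_right (f i) (f j) (g (f i))
    nlinarith
  · obtain ⟨i, hi, j, hj, hij⟩ := Finset.one_lt_card.1 (show 1 < s.card by omega)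
    refine ⟨i, hi, j, hj, hij, ?_⟩
    have := hdist (f i) (f j)
    nlinarith

lemma bern (s : ℝ) (hs0 : 0 < s) (hs1 : s < 1) (n : ℕ) :
    s * ((n + 1 : ℕ) : ℝ) ^ (s - 1) ≤ ((n + 1 : ℕ) : ℝ) ^ s - (n : ℝ) ^ s := by
  set m : ℝ := ((n + 1 : ℕ) : ℝ) with hm
  have hmn : (n : ℝ) = m - 1 := by rw [hm]; push_cast; ring
  have hm1 : 1 ≤ m := by rw [hm]; push_cast; linarith [(Nat.cast_nonneg n : (0 : ℝ) ≤ n)]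
  have hm0 : 0 < m := by linarith
  have hinv : 1 / m ≤ 1 := by rw [div_le_one hm0]; exact hm1
  have h := rpow_one_add_le_one_add_mul_self (s := -(1 / m)) (by linarith) hs0.le hs1.le
  have e : (n : ℝ) = m * (1 + -(1 / m)) := by rw [hmn]; field_simp; ring
  rw [e, Real.mul_rpow hm0.le (by linarith), Real.rpow_sub_one hm0.ne']
  have hp : 0 < m ^ s := by positivity
  have := mul_le_mul_of_nonneg_left h hp.le
  have e2 : m ^ s * (1 + s * -(1 / m)) = m ^ s - s * (m ^ s / m) := by ring
  linarith

lemma tour {M : Type} [MetricSpace M] (d A : ℝ) (hd : 1 < d) (hA : 0 < A)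
    (f : ℕ → M)
    (hpair : ∀ s : Finset ℕ, 2 ≤ s.card → ∃ i ∈ s, ∃ j ∈ s, i ≠ j ∧
      dist (f i) (f j) ≤ A * (s.card : ℝ) ^ (-(1 / d))) :
    ∀ (n : ℕ) (s : Finset ℕ), s.card = n → ∃ l : List ℕ, l.Perm s.toList ∧
      plen f l ≤ 2 * A / (1 - 1 / d) * (n : ℝ) ^ (1 - 1 / d) := by
  have hd1 : 1 / d < 1 := by rw [div_lt_one (by linarith)]; exact hd
  have hd0 : 0 < 1 / d := by positivity
  have hs : 0 < 1 - 1 / d := by linarith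
  intro n
  induction n with
  | zero =>
    intro s h
    refine ⟨s.toList, List.Perm.refl _, ?_⟩
    rw [Finset.card_eq_zero.1 h]
    simp only [Finset.toList_empty, plen]
    positivity
  | succ n ih =>
    intro s h
    rcases Nat.eq_zero_or_pos n with h0 | h0
    · subst h0
      refine ⟨s.toList, List.Perm.refl _, ?_⟩
      obtain ⟨a, rfl⟩ := Finset.card_eq_one.1 h
      simp only [Finset.toList_singleton, plen]
      positivity
    · obtain ⟨i, hi, j, hj, hij, hle⟩ := hpair s (by omega)
      obtain ⟨l, hl, hlen⟩ := ih (s.erase j) (by rw [Finset.card_erase_of_mem hj]; omega)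
      have hil : i ∈ l := by
        rw [hl.mem_iff]; simp [hi, hij]
      cases l with
      | nil => simp at hil
      | cons a t =>
        obtain ⟨t', h1, h2⟩ := plen_insert f i j t a hil
        refine ⟨a :: t', ?_, ?_⟩
        · have p1 : (a :: t').Perm (j :: a :: t) := (h1.cons a).trans (List.Perm.swap _ _ _)
          have p2 : (j :: a :: t).Perm (j :: (s.erase j).toList) := hl.cons j
          have p3 := Finset.toList_insert (Finset.notMem_erase j s)
          rw [Finset.insert_erase hj] at p3
          exact (p1.trans p2).trans p3.symm
        · have hb := bern (1 - 1 / d) hs (by linarith) n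
          rw [h] at hle
          have e : 1 - 1 / d - 1 = -(1 / d) := by ring
          rw [e] at hb
          have hq : 0 < 2 * A / (1 - 1 / d) := by positivity
          have hb2 := mul_le_mul_of_nonneg_left hb hq.le
          have e2 : 2 * A / (1 - 1 / d) * ((1 - 1 / d) * ((n + 1 : ℕ) : ℝ) ^ (-(1 / d)))
              = 2 * (A * ((n + 1 : ℕ) : ℝ) ^ (-(1 / d))) := by
            rw [← mul_assoc, div_mul_cancel₀ _ hs.ne', mul_assoc]
          rw [e2, mul_sub] at hb2
          linarith

lemma agg (s : ℝ) (hs0 : 0 < s) (hs1 : s < 1) (N : ℕ) (hN : 1 ≤ N) (T : ℝ) (hT : 0 < T)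
    (a : ℕ → ℝ) (ha : ∀ i, 0 ≤ a i) (hsum : ∑ i ∈ Finset.range N, a i = T) :
    ∑ i ∈ Finset.range N, a i ^ s ≤ (N : ℝ) ^ (1 - s) * T ^ s := by
  have hN0 : (0 : ℝ) < N := by exact_mod_cast hN
  have h := (Real.concaveOn_rpow hs0.le hs1.le).le_map_sum (t := Finset.range N)
    (w := fun _ => (N : ℝ)⁻¹) (p := a) (fun _ _ => by positivity)
    (by simp [hN0.ne']) (fun i _ => ha i)
  simp only [smul_eq_mul, ← Finset.mul_sum, hsum] at h
  rw [Real.mul_rpow (by positivity) hT.le, Real.inv_rpow hN0.le] at h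
  rw [Real.rpow_sub hN0, Real.rpow_one]
  have := mul_le_mul_of_nonneg_left h hN0.le
  rw [← mul_assoc, mul_inv_cancel₀ hN0.ne', one_mul] at this
  rw [div_eq_mul_inv, mul_assoc]
  exact this

lemma blocks {M : Type} [MetricSpace M] (f : ℕ → M) (B s D : ℝ) (hD : 0 ≤ D)
    (h : ∀ x y : M, dist x y ≤ D)
    (ht : ∀ s' : Finset ℕ, ∃ l : List ℕ, l.Perm s'.toList ∧ plen f l ≤ B * (s'.card : ℝ) ^ s)
    (b : ℕ → ℕ) (hb : Monotone b) (hb0 : b 0 = 0) :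
    ∀ k : ℕ, ∃ l : List ℕ, l.Perm (List.range (b k)) ∧
      (∀ i < k, ∀ t (ht : t < l.length), b i ≤ t → t < b (i + 1) →
        b i ≤ l[t] ∧ l[t] < b (i + 1)) ∧
      plen f l ≤ ∑ i ∈ Finset.range k, B * ((b (i + 1) - b i : ℕ) : ℝ) ^ s + k * D := by
  intro k
  induction k with
  | zero => exact ⟨[], by simp [hb0], by simp, by simp [plen]⟩
  | succ k ih =>
    obtain ⟨l, hl, hbl, hlen⟩ := ih
    obtain ⟨l', hl', hlen'⟩ := ht (Finset.Ico (b k) (b (k + 1)))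
    have hk : b k ≤ b (k + 1) := hb (Nat.le_succ k)
    have hlk : l.length = b k := by simpa using hl.length_eq
    have hmem' : ∀ a, a ∈ l' ↔ b k ≤ a ∧ a < b (k + 1) := by
      intro a; rw [hl'.mem_iff]; simp
    have hmem : ∀ a, a ∈ l ↔ a < b k := by
      intro a; rw [hl.mem_iff]; simp
    refine ⟨l ++ l', ?_, ?_, ?_⟩
    · rw [List.perm_ext_iff_of_nodup _ List.nodup_range]
      · intro a
        rw [List.mem_append, hmem, hmem', List.mem_range]
        omega
      · rw [List.nodup_append']
        refine ⟨hl.nodup_iff.2 List.nodup_range, hl'.nodup_iff.2 (Finset.nodup_toList _), ?_⟩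
        intro a h1 h2
        rw [hmem] at h1
        rw [hmem'] at h2
        omega
    · intro i hi t htl h1 h2
      rcases Nat.lt_succ_iff_lt_or_eq.1 hi with hi' | rfl
      · have : b (i + 1) ≤ b k := hb hi'
        have htl' : t < l.length := by omega
        rw [List.getElem_append_left htl']
        exact hbl i hi' t htl' h1 h2
      · rw [List.getElem_append_right (by omega)]
        exact (hmem' _).1 (List.getElem_mem _)
    · have := plen_append f D hD h l' l
      rw [Finset.sum_range_succ]
      rw [Nat.card_Ico] at hlen'
      push_cast at *
      linarith

end BRB

/-- Deterministic content of Corollary 1: in a connected metric space of diameter at most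
`D` and Minkowski dimension at most `d` (covering hypothesis with constant `C`), there is a
constant `K > 0` depending only on `C` and `d` such that for any `T` points partitioned into
`N` consecutive blocks (with boundaries `b 0 = 0 ≤ b 1 ≤ ⋯ ≤ b N = T`), the points can be
reordered within each block so that the total consecutive movement is at most
`K * N^(1/d) * T^(1-1/d) + N * D`. -/
theorem batched_reordering_bound (d C : ℝ) (hd : 1 < d) (hC : 0 < C) :
    ∃ K > 0, ∀ (M : Type) [MetricSpace M] [ConnectedSpace M] (D : ℝ),
      Metric.diam (Set.univ : Set M) ≤ D →
      (∀ ε : ℝ, 0 < ε → ε ≤ 1 → ∃ Z : Finset M,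
        (Z.card : ℝ) ≤ C * ε ^ (-d) ∧ ∀ x : M, ∃ z ∈ Z, dist x z < ε) →
      ∀ (T N : ℕ), 1 ≤ T → 1 ≤ N →
      ∀ (x : Fin T → M) (b : ℕ → ℕ), Monotone b → b 0 = 0 → b N = T →
      ∃ τ : Equiv.Perm (Fin T),
        (∀ i : ℕ, i < N → ∀ t : Fin T, b i ≤ (t : ℕ) → (t : ℕ) < b (i + 1) →
          b i ≤ ((τ t : Fin T) : ℕ) ∧ ((τ t : Fin T) : ℕ) < b (i + 1)) ∧
        pathLength x τ ≤
          K * (N : ℝ) ^ (1 / d) * (T : ℝ) ^ (1 - 1 / d) + (N : ℝ) * D := by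
  have hd1 : 1 / d < 1 := by rw [div_lt_one (by linarith)]; exact hd
  have hd0 : 0 < 1 / d := by positivity
  have hs : 0 < 1 - 1 / d := by linarith
  have hA : 0 < (2 + 2 * C) * (2 * C) ^ (1 / d) := by positivity
  refine ⟨2 * ((2 + 2 * C) * (2 * C) ^ (1 / d)) / (1 - 1 / d), by positivity, ?_⟩
  intro M _ _ D hD hcov T N hT hN x b hb hb0 hbN
  have hdist : ∀ p q : M, dist p q ≤ 2 * C := by
    obtain ⟨Z, hZ1, hZ2⟩ := hcov 1 one_pos le_rfl
    intro p q
    have := BRB.dist_le Z hZ2 p q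
    rw [Real.one_rpow] at hZ1
    linarith
  have hD0 : 0 ≤ D := le_trans Metric.diam_nonneg hD
  have hdD : ∀ p q : M, dist p q ≤ D := fun p q =>
    (Metric.dist_le_diam_of_mem (Metric.isBounded_iff.2 ⟨2 * C, fun p _ q _ => hdist p q⟩)
      (Set.mem_univ p) (Set.mem_univ q)).trans hD
  let f : ℕ → M := fun n => if h : n < T then x ⟨n, h⟩ else x ⟨0, hT⟩
  have hf : ∀ t : Fin T, f t = x t := fun t => by simp [f]
  have htour := BRB.tour d _ hd hA f (fun s hs => BRB.pair d C hd hC hdist hcov f s hs)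
  obtain ⟨l, hl, hbl, hlen⟩ := BRB.blocks f _ (1 - 1 / d) D hD0 hdD (fun s => htour _ s rfl)
    b hb hb0 N
  rw [hbN] at hl
  have hlT : l.length = T := by simpa using hl.length_eq
  have hnd : l.Nodup := hl.nodup_iff.2 List.nodup_range
  have hlt : ∀ t (h : t < l.length), l[t] < T := by
    intro t h
    have := hl.mem_iff.1 (List.getElem_mem h)
    simpa using this
  subst hlT
  let g : Fin l.length → Fin l.length := fun t => ⟨l[(t : ℕ)], hlt t t.2⟩
  have hg : Function.Injective g := by
    intro s t hst
    have : l[(s : ℕ)] = l[(t : ℕ)] := congrArg Fin.val hst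
    exact Fin.ext ((hnd.getElem_inj_iff).1 this)
  refine ⟨Equiv.ofBijective g (Finite.injective_iff_bijective.1 hg), ?_, ?_⟩
  · intro i hi t h1 h2
    exact hbl i hi t t.2 h1 h2
  · have hpl : pathLength x (Equiv.ofBijective g (Finite.injective_iff_bijective.1 hg))
        = BRB.plen f l := by
      rw [BRB.plen_eq, pathLength]
      refine Finset.sum_congr rfl fun i _ => ?_
      by_cases h : (i : ℕ) + 1 < l.length
      · rw [dif_pos h, dif_pos h, Equiv.ofBijective_apply, Equiv.ofBijective_apply, ← hf, ← hf]
      · rw [dif_neg h, dif_neg h]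
    rw [hpl]
    refine hlen.trans ?_
    have hsum : ∑ i ∈ Finset.range N, ((b (i + 1) - b i : ℕ) : ℝ) = (l.length : ℝ) := by
      rw [← Nat.cast_sum, Finset.sum_range_tsub hb, hbN, hb0, Nat.sub_zero]
    have hagg := BRB.agg (1 - 1 / d) hs (by linarith) N hN (l.length : ℝ) (by exact_mod_cast hT)
      (fun i => ((b (i + 1) - b i : ℕ) : ℝ)) (fun i => Nat.cast_nonneg _) hsum
    rw [← Finset.mul_sum]
    rw [sub_sub_cancel] at hagg
    rw [mul_assoc]
    have := mul_le_mul_of_nonneg_left hagg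
      (show 0 ≤ 2 * ((2 + 2 * C) * (2 * C) ^ (1 / d)) / (1 - 1 / d) by positivity)
    linarith
end

section
/- Let (M, dist) be a metric space and let x₁, …, xₙ ∈ M be a list of points taking at most K distinct values, all of which lie within pairwise distance at most D of each other. Then there exists a permutation σ of {1,…,n} such that Σ_{i=1}^{n-1} dist(x_{σ(i)}, x_{σ(i+1)}) ≤ (K − 1)·D. -/
open scoped BigOperators

/-- Observation underlying the `K`-armed bandit application: if the points `x₁, …, xₙ` take
at most `K` distinct values, all within pairwise distance `D` of each other, then grouping
equal points yields a path through them of length at most `(K - 1) * D`. -/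
theorem path_through_few_values {M : Type*} [MetricSpace M] {n : ℕ} (hn : 1 ≤ n)
    (x : Fin n → M) (K : ℕ) (D : ℝ) (S : Finset M)
    (hcard : S.card ≤ K) (hmem : ∀ i : Fin n, x i ∈ S)
    (hdiam : ∀ a ∈ S, ∀ b ∈ S, dist a b ≤ D) :
    ∃ σ : Equiv.Perm (Fin n), pathLength x σ ≤ ((K : ℝ) - 1) * D := by
  classical
  have i0 : Fin n := ⟨0, hn⟩
  have hD : 0 ≤ D := le_trans dist_nonneg (hdiam _ (hmem i0) _ (hmem i0))
  let e := S.equivFin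
  let f : Fin n → Fin S.card := fun i => e ⟨x i, hmem i⟩
  have hf : ∀ i j, f i = f j → x i = x j := by
    intro i j h
    have := e.injective h
    simpa using this
  refine ⟨Tuple.sort f, ?_⟩
  have hmono : Monotone (f ∘ Tuple.sort f) := Tuple.monotone_sort f
  generalize Tuple.sort f = σ at hmono
  let g : ℕ → ℝ := fun i => ((f (σ ⟨min i (n - 1), by omega⟩) : ℕ) : ℝ)
  have hstep : ∀ i : Fin n,
      (if h : (i : ℕ) + 1 < n then dist (x (σ i)) (x (σ ⟨(i : ℕ) + 1, h⟩)) else 0)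
        ≤ D * (g ((i : ℕ) + 1) - g i) := by
    intro i
    have hi := i.isLt
    have e1 : (⟨min (i : ℕ) (n - 1), by omega⟩ : Fin n) = i := Fin.ext (by simp; omega)
    split_ifs with h
    · have e2 : (⟨min ((i : ℕ) + 1) (n - 1), by omega⟩ : Fin n) = ⟨(i : ℕ) + 1, h⟩ :=
        Fin.ext (by simp; omega)
      simp only [g, e1, e2]
      have hle : f (σ i) ≤ f (σ ⟨(i : ℕ) + 1, h⟩) :=
        hmono (show i ≤ ⟨(i : ℕ) + 1, h⟩ from Fin.le_def.2 (by simp))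
      rcases hle.eq_or_lt with heq | hlt
      · rw [hf _ _ heq, heq]; simp
      · have h1 : ((f (σ i) : ℕ) : ℝ) + 1 ≤ ((f (σ ⟨(i : ℕ) + 1, h⟩) : ℕ) : ℝ) := by
          exact_mod_cast hlt
        have h2 := hdiam _ (hmem (σ i)) _ (hmem (σ ⟨(i : ℕ) + 1, h⟩))
        nlinarith
    · have e2 : (⟨min ((i : ℕ) + 1) (n - 1), by omega⟩ : Fin n) = i :=
        Fin.ext (by simp; omega)
      simp only [g, e1, e2]
      simp
  have hsum : pathLength x σ ≤ D * (g n - g 0) := by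
    unfold pathLength
    refine (Finset.sum_le_sum fun i _ => hstep i).trans ?_
    rw [← Finset.mul_sum, ← Finset.sum_range (fun i => g (i + 1) - g i), Finset.sum_range_sub]
  have hg0 : 0 ≤ g 0 := Nat.cast_nonneg _
  have hgn : g n + 1 ≤ K := by
    have h1 := (f (σ ⟨min n (n - 1), by omega⟩)).isLt
    have h2 := lt_of_lt_of_le h1 hcard
    simp only [g]
    exact_mod_cast h2
  nlinarith
end
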